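/- Let S be a monoid with zero (0 ≠ 1) and let A be a locally cyclic pointed S-act admitting a projective cover f : P → A in the category of pointed S-acts. Then P is indecomposable as a pointed S-act, P is isomorphic to S • e for some idempotent e ∈ S, and A is cyclic. -/

import Mathlib

universe u

/-- A subact of a pointed `S`-act: contains `0` and is closed under the
action. -/
def IsPSubact (S : Type u) [MonoidWithZero S] {A : Type u} [Zero A]
    [MulActionWithZero S A] (B : Set A) : Prop :=
  (0 : A) ∈ B ∧ ∀ (s : S) ⦃a : A⦄, a ∈ B → s • a ∈ B

/-- `P` is projective in the category of pointed `S`-acts. -/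
def PActProjective (S : Type u) [MonoidWithZero S] (P : Type u) [Zero P]
    [MulActionWithZero S P] : Prop :=
  ∀ (B C : Type u) [Zero B] [Zero C] [MulActionWithZero S B]
    [MulActionWithZero S C] (π : B → C) (f : P → C),
    Function.Surjective π → (∀ (s : S) (b : B), π (s • b) = s • π b) →
    π 0 = 0 →
    (∀ (s : S) (x : P), f (s • x) = s • f x) → f 0 = 0 →
    ∃ h : P → B,
      (∀ (s : S) (x : P), h (s • x) = s • h x) ∧ h 0 = 0 ∧ π ∘ h = f

/-- `f : P → A` is a projective cover of the pointed `S`-act `A` in the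
category of pointed `S`-acts. -/
def IsPProjCover (S : Type u) [MonoidWithZero S] (P : Type u) [Zero P]
    [MulActionWithZero S P] (A : Type u) [Zero A] [MulActionWithZero S A]
    (f : P → A) : Prop :=
  Function.Surjective f ∧ f 0 = 0 ∧
    (∀ (s : S) (x : P), f (s • x) = s • f x) ∧ PActProjective S P ∧
    ∀ B : Set P, IsPSubact S B → B ≠ Set.univ → f '' B ≠ Set.univ

/-- A pointed `S`-act is indecomposable if it is not the union of two proper
subacts intersecting in `{0}`. -/
def PIndecomposable (S : Type u) [MonoidWithZero S] (A : Type u) [Zero A]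
    [MulActionWithZero S A] : Prop :=
  ¬ ∃ B C : Set A, IsPSubact S B ∧ IsPSubact S C ∧ B ≠ Set.univ ∧
      C ≠ Set.univ ∧ B ∪ C = Set.univ ∧ B ∩ C = {0}

/-- The graph of the canonical map from the free pointed `S`-act on the underlying set of `P`
to `P`: pairs of a family with at most one nonzero coordinate and its image in `P`. -/
def freePActGraph (S : Type u) [MonoidWithZero S] (P : Type u) [Zero P]
    [MulActionWithZero S P] : SubMulAction S ((P → S) × P) where
  carrier := {u | ∃ x : P, (∀ y, y ≠ x → u.1 y = 0) ∧ u.2 = u.1 x • x}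
  smul_mem' := by
    rintro s u ⟨x, hx, hu⟩
    refine ⟨x, fun y hy => ?_, ?_⟩
    · simp [hx y hy]
    · simp [hu, mul_smul]

instance freePActGraphZero (S : Type u) [MonoidWithZero S] (P : Type u) [Zero P]
    [MulActionWithZero S P] : Zero (freePActGraph S P) :=
  ⟨⟨0, 0, fun _ _ => rfl, (smul_zero _).symm⟩⟩

instance freePActGraphMulActionWithZero (S : Type u) [MonoidWithZero S] (P : Type u) [Zero P]
    [MulActionWithZero S P] : MulActionWithZero S (freePActGraph S P) where
  smul_zero s := Subtype.ext (smul_zero (A := (P → S) × P) s)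
  zero_smul u := Subtype.ext (zero_smul S (u : (P → S) × P))

/-- A projective pointed act has coordinate maps to `S`: every `p` has exactly one relevant
coordinate `x`, and it is recovered from it as `φ p x • x`. -/
theorem PActProjective.exists_coordinates {S : Type u} [MonoidWithZero S] {P : Type u} [Zero P]
    [MulActionWithZero S P] (hP : PActProjective S P) :
    ∃ φ : P → P → S, (∀ (s : S) (p x : P), φ (s • p) x = s * φ p x) ∧
      ∀ p, ∃ x, (∀ y, y ≠ x → φ p y = 0) ∧ p = φ p x • x := by
  classical
  obtain ⟨h, hsmul, -, hid⟩ := hP (freePActGraph S P) P (fun u => u.1.2) id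
    (fun p => ⟨⟨(Pi.single p 1, p), p, fun y hy => by simp [hy], by simp⟩, rfl⟩)
    (fun _ _ => rfl) rfl (fun _ _ => rfl) rfl
  refine ⟨fun p => (h p).1.1, fun s p x => ?_, fun p => ?_⟩
  · simp [hsmul]
  · obtain ⟨x, hx, hpx⟩ := (h p).2
    exact ⟨x, hx, (congrFun hid p).symm.trans hpx⟩

/-- In a projective cover of a locally cyclic pointed act, a single coordinate suffices. -/
theorem IsPProjCover.exists_generator {S : Type u} [MonoidWithZero S]
    {A : Type u} [Zero A] [MulActionWithZero S A]
    (hlc : ∀ a₁ a₂ : A, ∃ b : A, (∃ s : S, a₁ = s • b) ∧ ∃ s : S, a₂ = s • b)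
    {P : Type u} [Zero P] [MulActionWithZero S P]
    {f : P → A} (hcover : IsPProjCover S P A f) :
    ∃ (x : P) (φ : P → S), (∀ (s : S) (p : P), φ (s • p) = s * φ p) ∧ ∀ p, p = φ p • x := by
  obtain ⟨hsurj, -, hsmul, hproj, hmin⟩ := hcover
  obtain ⟨φ, hφ, hcoord⟩ := hproj.exists_coordinates
  have hφ0 (x : P) : φ 0 x = 0 := by simpa using hφ 0 0 x
  by_cases hne : ∃ p : P, p ≠ 0
  · obtain ⟨p, hp⟩ := hne
    obtain ⟨x, -, hpx⟩ := hcoord p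
    have hφp : φ p x ≠ 0 := fun h => hp (by rw [hpx, h, zero_smul])
    refine ⟨x, fun q => φ q x, fun s q => hφ s q x, ?_⟩
    have hcompl : f '' {q | φ q x = 0} ≠ Set.univ := by
      refine hmin _ ⟨hφ0 x, fun s q (hq : φ q x = 0) => ?_⟩ fun h => hφp ?_
      · simp [hφ, hq]
      · exact (Set.eq_univ_iff_forall.mp h) p
    obtain ⟨a, ha⟩ := (Set.ne_univ_iff_exists_notMem _).mp hcompl
    have hsub : IsPSubact S {q : P | q = φ q x • x} := by
      refine ⟨?_, fun s q (hq : q = φ q x • x) => ?_⟩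
      · simp [hφ0]
      · change s • q = φ (s • q) x • x
        rw [hφ, mul_smul, ← hq]
    by_contra hall
    refine hmin _ hsub (fun h => hall (Set.eq_univ_iff_forall.mp h)) ?_
    refine Set.eq_univ_of_forall fun a' => ?_
    obtain ⟨b, ⟨s, hs⟩, t, ht⟩ := hlc a a'
    obtain ⟨q, rfl⟩ := hsurj b
    obtain ⟨y, hy, hqy⟩ := hcoord q
    obtain rfl | hxy := eq_or_ne x y
    · exact ⟨t • q, hsub.2 t hqy, by rw [hsmul, ht]⟩
    · exact (ha ⟨s • q, by simp [hφ, hy x hxy], by rw [hsmul, hs]⟩).elim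
  · push Not at hne
    exact ⟨0, fun q => φ q 0, fun s q => hφ s q 0, fun q => by rw [hne q, smul_zero]⟩

/-- if `A` is a locally cyclic pointed `S`-act with a
projective cover `f : P → A` in the category of pointed `S`-acts, then `P` is
indecomposable, `P` is isomorphic to `S • e` for an idempotent `e ∈ S` via an
equivariant zero-preserving bijection, and `A` is cyclic. -/
theorem stmt_15 {S : Type u} [MonoidWithZero S] (h01 : (0 : S) ≠ 1)
    {A : Type u} [Zero A] [MulActionWithZero S A]
    (hlc : ∀ a₁ a₂ : A, ∃ b : A, (∃ s : S, a₁ = s • b) ∧ ∃ s : S, a₂ = s • b)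
    {P : Type u} [Zero P] [MulActionWithZero S P]
    (f : P → A) (hcover : IsPProjCover S P A f) :
    PIndecomposable S P ∧
      (∃ e : S, e * e = e ∧
        ∃ φ : P → S, Function.Injective φ ∧
          Set.range φ = {x : S | ∃ s : S, x = s * e} ∧ φ 0 = 0 ∧
          ∀ (s : S) (x : P), φ (s • x) = s * φ x) ∧
      ∃ g : A, ∀ a : A, ∃ s : S, a = s • g := by
  obtain ⟨x, φ, hφ, hx⟩ := hcover.exists_generator hlc
  obtain ⟨hsurj, -, hsmul, -⟩ := hcover
  refine ⟨?_, ⟨φ x, ?_, φ, fun p q hpq => ?_, ?_, ?_, hφ⟩, f x, fun a => ?_⟩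
  · rintro ⟨B, C, hB, hC, hBne, hCne, hBC, -⟩
    have eq_univ {D : Set P} (hD : IsPSubact S D) (hxD : x ∈ D) : D = Set.univ :=
      Set.eq_univ_of_forall fun p => by
        rw [hx p]
        exact hD.2 _ hxD
    rcases (Set.eq_univ_iff_forall.mp hBC) x with h | h
    · exact hBne (eq_univ hB h)
    · exact hCne (eq_univ hC h)
  · rw [← hφ, ← hx]
  · rw [hx p, hpq, ← hx]
  · ext s
    constructor
    · rintro ⟨p, rfl⟩
      exact ⟨φ p, by rw [← hφ, ← hx]⟩
    · rintro ⟨t, rfl⟩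
      exact ⟨t • x, hφ t x⟩
  · simpa using hφ 0 0
  · obtain ⟨p, rfl⟩ := hsurj a
    exact ⟨φ p, by rw [← hsmul, ← hx]⟩
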